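/- arXiv:1610.08283 — 3 statements merged into one kernel-verified Lean document; each statement's English description precedes it below -/
import Mathlib

section
/- Let ε > 0 and let (x_k)_{k≥0} be a sequence of nonnegative real numbers such that ε·x₀ ≤ 1/2 and x_k·(1 + ε·x_k) ≤ x_{k−1} for every k ≥ 1. Then x_k ≤ 2/(ε·k) for every k ≥ 1. -/
/-- **Discrete recursion lemma.** If `(x_k)` is a nonnegative sequence with
`ε·x₀ ≤ 1/2` and `x_k·(1 + ε·x_k) ≤ x_{k−1}` for every `k ≥ 1`, then
`x_k ≤ 2/(ε·k)` for every `k ≥ 1`. -/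
theorem discrete_recursion_decay (ε : ℝ) (x : ℕ → ℝ) (hε : 0 < ε)
    (hx_nonneg : ∀ k, 0 ≤ x k)
    (h0 : ε * x 0 ≤ 1 / 2)
    (hrec : ∀ k : ℕ, 1 ≤ k → x k * (1 + ε * x k) ≤ x (k - 1)) :
    ∀ k : ℕ, 1 ≤ k → x k ≤ 2 / (ε * k) := by
  have key : ∀ n : ℕ, ε * x n * (n + 4) ≤ 2 := by
    intro n
    induction n with
    | zero => push_cast; linarith
    | succ n ih =>
      have hstep : ε * x (n + 1) * (1 + ε * x (n + 1)) ≤ ε * x n := by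
        have := mul_le_mul_of_nonneg_left (hrec (n + 1) (by omega)) hε.le
        simpa [mul_assoc] using this
      have ht : 0 ≤ ε * x (n + 1) := mul_nonneg hε.le (hx_nonneg _)
      generalize ε * x (n + 1) = t at hstep ht ⊢
      have hn : (0 : ℝ) ≤ n := n.cast_nonneg
      have hle : t * (1 + t) * (n + 4) ≤ 2 :=
        (mul_le_mul_of_nonneg_right hstep (by positivity)).trans ih
      push_cast
      by_contra! h
      have hlt : t * (n + 4) < 1 := by
        have hpos : 0 < t * (1 - t * (n + 4)) := by linarith
        linarith [pos_of_mul_pos_right hpos ht]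
      linarith [mul_nonneg ht hn]
  intro k hk
  have hk' : (0 : ℝ) < k := by exact_mod_cast hk
  rw [le_div_iff₀ (by positivity)]
  linarith [key k, mul_nonneg hε.le (hx_nonneg k)]
end

section
/- Let F : ℝ → ℝ be defined by F(x) = (1 − e^{−x})/x for x ≠ 0 and F(0) = 1. Let V be a finite-dimensional complex inner product space, let T be a self-adjoint endomorphism of V with operator norm ‖T‖ ≤ M, and define F(T) := Σ_{n=0}^∞ (−1)^n T^n/(n+1)! (the convergent power series for F applied to T). Then for every v ∈ V one has ⟨F(T)v, v⟩ ≥ ((1 − e^{−1})/(1 + M))·‖v‖². -/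
open scoped InnerProductSpace

/-- The power series of `(1 - e^{-x})/x` converges in every Banach algebra. -/
theorem summable_one_sub_exp_neg_div_series {𝕜 A : Type*} [RCLike 𝕜] [NormedRing A]
    [NormedAlgebra 𝕜 A] [CompleteSpace A] (a : A) :
    Summable fun n : ℕ => ((-1 : 𝕜) ^ n / ((n + 1).factorial : 𝕜)) • a ^ n := by
  refine Summable.of_norm_bounded (NormedSpace.norm_expSeries_summable' (𝕂 := 𝕜) a) fun n => ?_
  rw [norm_smul, norm_smul]
  gcongr
  simp only [norm_div, norm_pow, norm_neg, norm_one, one_pow, RCLike.norm_natCast, norm_inv,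
    one_div]
  gcongr
  omega

theorem mul_tsum_one_sub_exp_neg_div_series (x : ℝ) :
    x * ∑' n : ℕ, (-1 : ℝ) ^ n / ((n + 1).factorial : ℝ) * x ^ n = 1 - Real.exp (-x) := by
  have h := NormedSpace.expSeries_div_hasSum_exp (-x)
  rw [← Real.exp_eq_exp_ℝ] at h
  rw [← h.tsum_eq, h.summable.tsum_eq_zero_add, ← tsum_mul_left]
  simp only [pow_zero, Nat.factorial_zero, Nat.cast_one, div_one, sub_add_cancel_left,
    ← tsum_neg]
  refine tsum_congr fun n => ?_
  rw [neg_pow x]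
  ring

theorem div_one_add_abs_le_tsum (x : ℝ) :
    (1 - Real.exp (-1)) / (1 + |x|) ≤
      ∑' n : ℕ, (-1 : ℝ) ^ n / ((n + 1).factorial : ℝ) * x ^ n := by
  have hpos : 0 < Real.exp (-1) := Real.exp_pos _
  have hle : Real.exp (-1) < 1 := by simp
  rcases eq_or_ne x 0 with rfl | hx
  · rw [tsum_eq_single 0 fun n hn => by simp [hn]]
    simp [hpos.le]
  have hS := mul_tsum_one_sub_exp_neg_div_series x
  generalize ∑' n : ℕ, (-1 : ℝ) ^ n / ((n + 1).factorial : ℝ) * x ^ n = S at hS ⊢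
  rw [div_le_iff₀ (by positivity)]
  rcases hx.lt_or_gt with hneg | hx0
  · have hexp := Real.add_one_le_exp (-x)
    have hS1 : 1 ≤ S := by nlinarith
    nlinarith [abs_nonneg x]
  rw [abs_of_pos hx0]
  rcases le_total x 1 with h1 | h1
  · have hconv := convexOn_exp.2 (Set.mem_univ 0) (Set.mem_univ (-1)) (sub_nonneg.2 h1) hx0.le
      (sub_add_cancel 1 x)
    simp only [smul_eq_mul, mul_zero, mul_neg, mul_one, zero_add, Real.exp_zero] at hconv
    have hS1 : 1 - Real.exp (-1) ≤ S := by
      refine le_of_mul_le_mul_left ?_ hx0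
      linarith
    nlinarith
  · have hexp : Real.exp (-x) ≤ Real.exp (-1) := Real.exp_le_exp.2 (by linarith)
    have hS0 : 0 < S := pos_of_mul_pos_right (by rw [hS]; linarith) hx0.le
    linarith

/-- An operator that is diagonal in an orthonormal basis with real eigenvalues at least `c` is
bounded below by `c`. -/
theorem OrthonormalBasis.le_re_inner_of_apply_eq_smul {ι 𝕜 V : Type*} [Fintype ι] [RCLike 𝕜]
    [NormedAddCommGroup V] [InnerProductSpace 𝕜 V] (b : OrthonormalBasis ι 𝕜 V) (S : V →ₗ[𝕜] V)
    (μ : ι → ℝ) (hS : ∀ i, S (b i) = (μ i : 𝕜) • b i) {c : ℝ} (hc : ∀ i, c ≤ μ i) (v : V) :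
    c * ‖v‖ ^ 2 ≤ RCLike.re ⟪S v, v⟫_𝕜 := by
  have hSv : S v = ∑ i, (⟪b i, v⟫_𝕜 * (μ i : 𝕜)) • b i := by
    conv_lhs => rw [← b.sum_repr' v]
    simp [hS, smul_smul]
  have hinner : RCLike.re ⟪S v, v⟫_𝕜 = ∑ i, μ i * ‖⟪b i, v⟫_𝕜‖ ^ 2 := by
    rw [hSv, sum_inner, map_sum]
    refine Finset.sum_congr rfl fun i _ => ?_
    rw [inner_smul_left, map_mul (starRingEnd 𝕜), RCLike.conj_ofReal, mul_right_comm, RCLike.conj_mul]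
    norm_cast
    rw [mul_comm]
  rw [hinner, ← b.sum_sq_norm_inner_right v, Finset.mul_sum]
  gcongr with i
  exact hc i

/-- If `T` is a self-adjoint endomorphism of a finite-dimensional complex inner product space
with `‖T‖ ≤ M`, and `F(T) = Σ (−1)^n T^n/(n+1)!` is the power series of
`F(x) = (1 − e^{−x})/x` applied to `T`, then `⟨F(T)v, v⟩ ≥ ((1 − e^{−1})/(1 + M))·‖v‖²`. -/
theorem operator_one_sub_exp_neg_div_lower_bound
    {V : Type*} [NormedAddCommGroup V] [InnerProductSpace ℂ V] [FiniteDimensional ℂ V]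
    (T : V →L[ℂ] V) (hT : IsSelfAdjoint T) (M : ℝ) (hM : ‖T‖ ≤ M) (v : V) :
    (1 - Real.exp (-1)) / (1 + M) * ‖v‖ ^ 2 ≤
      RCLike.re (⟪(∑' n : ℕ, ((-1 : ℂ) ^ n / ((n + 1).factorial : ℂ)) • T ^ n) v, v⟫_ℂ) := by
  have : CompleteSpace V := FiniteDimensional.complete ℂ V
  have hsymm : (T : V →ₗ[ℂ] V).IsSymmetric := hT.isSymmetric
  set b := hsymm.eigenvectorBasis rfl
  set ev := hsymm.eigenvalues rfl
  have hTb (i) : T (b i) = (ev i : ℂ) • b i := hsymm.apply_eigenvectorBasis rfl i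
  have hpow (n : ℕ) (i) : (T ^ n) (b i) = (ev i : ℂ) ^ n • b i := by
    induction n with
    | zero => simp
    | succ n ih =>
      rw [pow_succ, mul_apply_eq_comp, hTb, map_smul, ih, smul_smul, pow_succ']
  refine b.le_re_inner_of_apply_eq_smul
    (∑' n : ℕ, ((-1 : ℂ) ^ n / ((n + 1).factorial : ℂ)) • T ^ n : V →L[ℂ] V).toLinearMap
    (fun i => ∑' n : ℕ, (-1 : ℝ) ^ n / ((n + 1).factorial : ℝ) * ev i ^ n)
    (fun i => ?_) (fun i => ?_) v
  · have hsum := (summable_one_sub_exp_neg_div_series (𝕜 := ℂ) T).hasSum.mapL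
      (ContinuousLinearMap.apply ℂ V (b i))
    have hscalar := (((summable_one_sub_exp_neg_div_series (𝕜 := ℝ) (ev i)).hasSum.mapL
      Complex.ofRealCLM).smul_const (b i))
    refine hsum.unique ?_
    convert hscalar using 2 with n
    · simp [hpow, smul_smul]
    · rfl
  · have hev : |ev i| ≤ M := by
      have hle := T.le_opNorm (b i)
      rw [hTb, norm_smul, b.norm_eq_one] at hle
      simp only [mul_one, Complex.norm_real, Real.norm_eq_abs] at hle
      exact hle.trans hM
    refine le_trans ?_ (div_one_add_abs_le_tsum (ev i))
    gcongr
    simp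
end

section
/- Let m ≥ 6 be an integer, let B be the open unit ball in ℝ^m centered at 0, let u : B → ℝ be nonnegative, smooth on B∖{0}, and such that ∫_B u² < ∞ and ∫_{B∖{0}} |∇u|² < ∞, and let f : B → ℝ be locally integrable. Suppose that −Σᵢ ∂²u/∂xᵢ²(x) ≤ f(x) for every x ∈ B∖{0}. Then for every smooth, compactly supported, nonnegative test function φ on B one has ∫_B u·(−Σᵢ ∂²φ/∂xᵢ²) ≤ ∫_B f·φ; that is, the differential inequality Δu ≤ f (with Δ the geometers' nonnegative Laplacian) holds on all of B in the sense of distributions. -/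
open MeasureTheory

/-- The sum of the pure second partial derivatives `Σᵢ ∂²u/∂xᵢ²` on Euclidean space
(so the geometers' nonnegative Laplacian is `Δu = −rawLaplacian m u`). -/
noncomputable def rawLaplacian (m : ℕ) (u : EuclideanSpace ℝ (Fin m) → ℝ)
    (x : EuclideanSpace ℝ (Fin m)) : ℝ :=
  ∑ i : Fin m, iteratedFDeriv ℝ 2 u x ![EuclideanSpace.single i 1, EuclideanSpace.single i 1]

open Filter Topology Metric Laplacian SchwartzMap
open scoped ContDiff

theorem rawLaplacian_eq_laplacian {m : ℕ} (u : EuclideanSpace ℝ (Fin m) → ℝ) :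
    rawLaplacian m u = Δ u := by
  rw [InnerProductSpace.laplacian_eq_iteratedFDeriv_orthonormalBasis u
    (EuclideanSpace.basisFun (Fin m) ℝ)]
  ext x
  simp [rawLaplacian]

theorem Filter.EventuallyEq.rawLaplacian_eq {m : ℕ} {u v : EuclideanSpace ℝ (Fin m) → ℝ}
    {x : EuclideanSpace ℝ (Fin m)} (h : u =ᶠ[𝓝 x] v) :
    rawLaplacian m u x = rawLaplacian m v x := by
  simp only [rawLaplacian, (h.iteratedFDeriv ℝ 2).self_of_nhds]

theorem rawLaplacian_eq_zero_of_notMem_tsupport {m : ℕ} {u : EuclideanSpace ℝ (Fin m) → ℝ}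
    {x : EuclideanSpace ℝ (Fin m)} (hx : x ∉ tsupport u) : rawLaplacian m u x = 0 := by
  have h : iteratedFDeriv ℝ 2 u x = 0 :=
    image_eq_zero_of_notMem_tsupport fun h' => hx (tsupport_iteratedFDeriv_subset 2 h')
  simp [rawLaplacian, h]

theorem abs_rawLaplacian_le {m : ℕ} (u : EuclideanSpace ℝ (Fin m) → ℝ)
    (x : EuclideanSpace ℝ (Fin m)) :
    |rawLaplacian m u x| ≤ m * ‖iteratedFDeriv ℝ 2 u x‖ := by
  calc |rawLaplacian m u x|
      ≤ ∑ i : Fin m, |iteratedFDeriv ℝ 2 u x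
          ![EuclideanSpace.single i 1, EuclideanSpace.single i 1]| :=
        Finset.abs_sum_le_sum_abs _ _
    _ ≤ ∑ _i : Fin m, ‖iteratedFDeriv ℝ 2 u x‖ := by
        refine Finset.sum_le_sum fun i _ => ?_
        have h := (iteratedFDeriv ℝ 2 u x).le_opNorm
          ![EuclideanSpace.single i 1, EuclideanSpace.single i 1]
        simpa [Fin.prod_univ_two] using h
    _ = m * ‖iteratedFDeriv ℝ 2 u x‖ := by simp

theorem ContDiff.continuous_rawLaplacian {m : ℕ} {u : EuclideanSpace ℝ (Fin m) → ℝ}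
    (hu : ContDiff ℝ 2 u) : Continuous (rawLaplacian m u) := by
  have h : Continuous (iteratedFDeriv ℝ 2 u) := hu.continuous_iteratedFDeriv (by norm_num)
  unfold rawLaplacian
  fun_prop

/-- Multiplying by a cutoff function replaces a function smooth on an open set by one that is
smooth everywhere, without changing it near a given compact subset. -/
theorem ContDiffOn.exists_contDiff_hasCompactSupport_eventuallyEq {m : ℕ}
    {U K : Set (EuclideanSpace ℝ (Fin m))} {u : EuclideanSpace ℝ (Fin m) → ℝ} (hU : IsOpen U)
    (hu : ContDiffOn ℝ ∞ u U) (hK : IsCompact K) (hKU : K ⊆ U) :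
    ∃ v : EuclideanSpace ℝ (Fin m) → ℝ, ContDiff ℝ ∞ v ∧ HasCompactSupport v ∧
      ∀ x ∈ K, v =ᶠ[𝓝 x] u := by
  obtain ⟨L, hL, hKL, hLU⟩ := exists_compact_between hK hU hKU
  obtain ⟨θ, hθ1, hθ0, -⟩ := exists_contMDiffMap_one_nhds_of_subset_interior
    (modelWithCornersSelf ℝ (EuclideanSpace ℝ (Fin m))) (n := (⊤ : ℕ∞)) hK.isClosed hKL
  have hθ : ContDiff ℝ ∞ θ := θ.contMDiff.contDiff
  have hsupp : tsupport (fun x => θ x * u x) ⊆ L := by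
    refine closure_minimal (fun x hx => ?_) hL.isClosed
    by_contra hxL
    simp [hθ0 x hxL] at hx
  refine ⟨fun x => θ x * u x, ?_, hL.of_isClosed_subset (isClosed_tsupport _) hsupp, fun x hx => ?_⟩
  · refine (contMDiff_of_tsupport fun x hx => ContDiffAt.contMDiffAt ?_).contDiff
    exact hθ.contDiffAt.mul (hu.contDiffAt (hU.mem_nhds (hLU (hsupp hx))))
  · filter_upwards [hθ1.filter_mono (nhds_le_nhdsSet hx)] with y hy
    simp [hy]

/-- Green's identity for a test function supported in an open set where `u` is smooth. -/
theorem ContDiffOn.integral_mul_rawLaplacian {m : ℕ} {U : Set (EuclideanSpace ℝ (Fin m))}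
    {u g : EuclideanSpace ℝ (Fin m) → ℝ} (hU : IsOpen U) (hu : ContDiffOn ℝ ∞ u U)
    (hg : ContDiff ℝ ∞ g) (hgc : HasCompactSupport g) (hgU : tsupport g ⊆ U) :
    Continuous (fun x => u x * rawLaplacian m g x) ∧
      Integrable (fun x => rawLaplacian m u x * g x) ∧
      ∫ x, u x * rawLaplacian m g x = ∫ x, rawLaplacian m u x * g x := by
  obtain ⟨v, hv, hvc, hvu⟩ :=
    hu.exists_contDiff_hasCompactSupport_eventuallyEq hU hgc.isCompact hgU
  have h₁ : (fun x => u x * rawLaplacian m g x) = fun x => v x * rawLaplacian m g x := by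
    ext x
    by_cases hx : x ∈ tsupport g
    · rw [(hvu x hx).self_of_nhds]
    · simp [rawLaplacian_eq_zero_of_notMem_tsupport hx]
  have h₂ : (fun x => rawLaplacian m u x * g x) = fun x => rawLaplacian m v x * g x := by
    ext x
    by_cases hx : x ∈ tsupport g
    · rw [(hvu x hx).rawLaplacian_eq]
    · simp [image_eq_zero_of_notMem_tsupport hx]
  have hvL : Continuous (rawLaplacian m v) :=
    ContDiff.continuous_rawLaplacian (contDiff_infty.mp hv 2)
  have hgL : Continuous (rawLaplacian m g) :=
    ContDiff.continuous_rawLaplacian (contDiff_infty.mp hg 2)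
  rw [h₁, h₂]
  refine ⟨hv.continuous.mul hgL,
    (hvL.mul hg.continuous).integrable_of_hasCompactSupport hgc.mul_left, ?_⟩
  have h := SchwartzMap.integral_mul_laplacian_right_eq_left (μ := volume)
    (hvc.toSchwartzMap hv) (hgc.toSchwartzMap hg)
  simp only [SchwartzMap.laplacian_apply] at h
  rw [rawLaplacian_eq_laplacian, rawLaplacian_eq_laplacian]
  exact h

theorem integrableOn_ball_inv_norm_pow {m k : ℕ} (hk : k < m) (r : ℝ) :
    IntegrableOn (fun x : EuclideanSpace ℝ (Fin m) => (‖x‖ ^ k)⁻¹) (ball 0 r) := by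
  have : Nontrivial (EuclideanSpace ℝ (Fin m)) :=
    Module.nontrivial_of_finrank_pos (R := ℝ) (by simp; omega)
  rw [integrableOn_fun_norm_addHaar volume (f := fun y : ℝ => (y ^ k)⁻¹)]
  have h : IntegrableOn (fun y : ℝ => y ^ (m - 1 - k)) (Set.Ioo 0 r) :=
    ((continuous_pow _).integrableOn_Icc (a := 0) (b := r)).mono_set Set.Ioo_subset_Icc_self
  refine h.congr_fun (fun y hy => ?_) measurableSet_Ioo
  have hy0 : y ≠ 0 := hy.1.ne'
  have hm : m - 1 = (m - 1 - k) + k := by omega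
  simp only [finrank_euclideanSpace, Fintype.card_fin, smul_eq_mul]
  conv_rhs => rw [hm]
  rw [pow_add]
  field_simp

/-- Second derivatives of a test function times a rescaled Schwartz function blow up at most like
`‖x‖⁻²` at the origin, uniformly in the scale. -/
theorem SchwartzMap.exists_norm_sq_mul_abs_rawLaplacian_mul_comp_smul_le {m : ℕ}
    (φ β : 𝓢(EuclideanSpace ℝ (Fin m), ℝ)) :
    ∃ C : ℝ, ∀ c : ℝ, ∀ x : EuclideanSpace ℝ (Fin m), ‖x‖ ≤ 1 →
      ‖x‖ ^ 2 * |rawLaplacian m (fun y => φ y * β (c • y)) x| ≤ C := by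
  choose A _ hA using fun i => φ.decay 0 i
  choose B _ hB using fun i => β.decay i i
  refine ⟨m * ∑ i ∈ Finset.range 3, (Nat.choose 2 i : ℝ) * A i * B (2 - i), fun c x hx => ?_⟩
  have hβ : ContDiff ℝ ∞ fun y => β (c • y) := (β.smooth ⊤).comp (contDiff_const_smul c)
  have hscale (i : ℕ) : ‖x‖ ^ i * ‖iteratedFDeriv ℝ i (fun y => β (c • y)) x‖ ≤ B i := by
    have h := hB i (c • x)
    rw [iteratedFDeriv_comp_const_smul (i := i) c ((β.smooth ⊤).of_le (by exact_mod_cast le_top))]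
    rw [norm_smul, mul_pow] at h
    rw [norm_smul, norm_pow]
    linarith
  have hmul := norm_iteratedFDeriv_mul_le (n := 2) (contDiff_infty.mp (φ.smooth ⊤) 2)
    (contDiff_infty.mp hβ 2) x le_rfl
  calc ‖x‖ ^ 2 * |rawLaplacian m (fun y => φ y * β (c • y)) x|
      ≤ ‖x‖ ^ 2 * (m * ∑ i ∈ Finset.range 3, (Nat.choose 2 i : ℝ) * ‖iteratedFDeriv ℝ i φ x‖ *
          ‖iteratedFDeriv ℝ (2 - i) (fun y => β (c • y)) x‖) := by
        gcongr
        exact (abs_rawLaplacian_le _ x).trans (by gcongr)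
    _ = m * ∑ i ∈ Finset.range 3, (Nat.choose 2 i : ℝ) * ‖iteratedFDeriv ℝ i φ x‖ *
          (‖x‖ ^ 2 * ‖iteratedFDeriv ℝ (2 - i) (fun y => β (c • y)) x‖) := by
        simp only [Finset.mul_sum]
        exact Finset.sum_congr rfl fun i _ => by ring
    _ ≤ m * ∑ i ∈ Finset.range 3, (Nat.choose 2 i : ℝ) * A i * B (2 - i) := by
        refine mul_le_mul_of_nonneg_left (Finset.sum_le_sum fun i _ => ?_) (Nat.cast_nonneg m)
        have hAi : ‖iteratedFDeriv ℝ i φ x‖ ≤ A i := by simpa using hA i x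
        have hpow : ‖x‖ ^ 2 ≤ ‖x‖ ^ (2 - i) :=
          pow_le_pow_of_le_one (norm_nonneg x) hx (Nat.sub_le 2 i)
        have hA0 : 0 ≤ A i := (norm_nonneg _).trans hAi
        have hBi := (mul_le_mul_of_nonneg_right hpow (norm_nonneg _)).trans (hscale (2 - i))
        gcongr

/-- A test function, multiplied by cutoffs that vanish near the origin and tend to `1` away from
it, whose Laplacians are `O(‖x‖⁻²)` uniformly. -/
theorem ContDiff.exists_seq_tsupport_subset_diff_zero {m : ℕ}
    {φ : EuclideanSpace ℝ (Fin m) → ℝ} (hφ : ContDiff ℝ ∞ φ) (hφc : HasCompactSupport φ)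
    (hφ0 : ∀ x, 0 ≤ φ x) :
    ∃ (g : ℕ → EuclideanSpace ℝ (Fin m) → ℝ) (C : ℝ),
      (∀ n, ContDiff ℝ ∞ (g n)) ∧ (∀ n, HasCompactSupport (g n)) ∧
      (∀ n, tsupport (g n) ⊆ tsupport φ \ {0}) ∧ (∀ n x, 0 ≤ g n x) ∧ (∀ n x, g n x ≤ φ x) ∧
      (∀ n x, ‖x‖ ≤ 1 → ‖x‖ ^ 2 * |rawLaplacian m (g n) x| ≤ C) ∧
      ∀ x ≠ 0, ∀ᶠ n in atTop, g n =ᶠ[𝓝 x] φ := by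
  let β : ContDiffBump (0 : EuclideanSpace ℝ (Fin m)) := ⟨1, 2, one_pos, one_lt_two⟩
  let φs : 𝓢(EuclideanSpace ℝ (Fin m), ℝ) := hφc.toSchwartzMap hφ
  let βs : 𝓢(EuclideanSpace ℝ (Fin m), ℝ) := β.hasCompactSupport.toSchwartzMap β.contDiff
  obtain ⟨C, hC⟩ := SchwartzMap.exists_norm_sq_mul_abs_rawLaplacian_mul_comp_smul_le φs βs
  obtain ⟨A, hA⟩ : ∃ A, ∀ x, ‖iteratedFDeriv ℝ 2 φ x‖ ≤ A := by
    obtain ⟨A, -, hA⟩ := φs.decay 0 2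
    exact ⟨A, fun x => by simpa using! hA x⟩
  let w (n : ℕ) (x : EuclideanSpace ℝ (Fin m)) : ℝ := φ x * β ((n + 1 : ℝ) • x)
  have hw (n : ℕ) : ContDiff ℝ ∞ (w n) :=
    hφ.mul (β.contDiff.comp (contDiff_const_smul _))
  have hsub (n : ℕ) : tsupport (fun x => φ x - w n x) ⊆ tsupport φ := by
    refine closure_mono fun x hx => ?_
    contrapose! hx
    simp [w, Function.notMem_support.mp hx]
  refine ⟨fun n x => φ x - w n x, m * A + C, fun n => hφ.sub (hw n), fun n =>
    hφc.of_isClosed_subset (isClosed_tsupport _) (hsub n), fun n => ?_, fun n x => ?_,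
    fun n x => ?_, fun n x hx => ?_, fun x hx => ?_⟩
  · refine Set.subset_sdiff_singleton (hsub n) ?_
    rw [notMem_tsupport_iff_eventuallyEq]
    have hcont : Continuous fun x : EuclideanSpace ℝ (Fin m) => (n + 1 : ℝ) • x := by fun_prop
    have h := hcont.continuousAt.eventually_mem (x := 0)
      (s := closedBall 0 1) (by simpa using closedBall_mem_nhds _ one_pos)
    filter_upwards [h] with x hx
    simp [w, β.one_of_mem_closedBall hx]
  · have := β.le_one (x := (n + 1 : ℝ) • x)
    simp only [w]
    nlinarith [hφ0 x]
  · have := β.nonneg (x := (n + 1 : ℝ) • x)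
    simp only [w]
    nlinarith [hφ0 x]
  · have hL : rawLaplacian m (fun y => φ y - w n y) x = rawLaplacian m φ x -
        rawLaplacian m (w n) x := by
      have h : iteratedFDeriv ℝ 2 (fun y => φ y - w n y) x =
          iteratedFDeriv ℝ 2 φ x - iteratedFDeriv ℝ 2 (w n) x :=
        iteratedFDeriv_sub_apply (contDiff_infty.mp hφ 2).contDiffAt
          (contDiff_infty.mp (hw n) 2).contDiffAt
      simp [rawLaplacian, h]
    have h₁ : |rawLaplacian m φ x| ≤ m * A :=
      (abs_rawLaplacian_le φ x).trans (by gcongr; exact hA x)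
    have h₂ : ‖x‖ ^ 2 * |rawLaplacian m (w n) x| ≤ C := hC (n + 1) x hx
    have hx2 : ‖x‖ ^ 2 ≤ 1 := pow_le_one₀ (norm_nonneg x) hx
    rw [hL]
    calc ‖x‖ ^ 2 * |rawLaplacian m φ x - rawLaplacian m (w n) x|
        ≤ ‖x‖ ^ 2 * (|rawLaplacian m φ x| + |rawLaplacian m (w n) x|) := by
          gcongr
          exact norm_sub_le (rawLaplacian m φ x) _
      _ ≤ m * A + C := by
          nlinarith [abs_nonneg (rawLaplacian m φ x)]
  · have hx0 : 0 < ‖x‖ := norm_pos_iff.mpr hx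
    filter_upwards [tendsto_natCast_atTop_atTop.eventually_gt_atTop (2 / ‖x‖)] with n hn
    have hn' : 2 < ‖(n + 1 : ℝ) • x‖ := by
      rw [div_lt_iff₀ hx0] at hn
      rw [norm_smul, Real.norm_of_nonneg (by positivity)]
      nlinarith
    have hcont : Continuous fun y : EuclideanSpace ℝ (Fin m) => ‖(n + 1 : ℝ) • y‖ := by fun_prop
    filter_upwards [hcont.continuousAt.eventually (lt_mem_nhds hn')] with y hy
    have : β ((n + 1 : ℝ) • y) = 0 := β.zero_of_le_dist (by simpa using hy.le)
    simp [w, this]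

/-- **Removable point singularity for distributional subsolutions.** Let `m ≥ 6`, let `B` be the
open unit ball of `ℝ^m`, let `u ≥ 0` be smooth on `B ∖ {0}` with `∫_B u² < ∞` and
`∫_{B∖{0}} |∇u|² < ∞`, let `f` be locally integrable on `B`, and suppose `Δu ≤ f` pointwise on
`B ∖ {0}` (with `Δ = −Σᵢ ∂²/∂xᵢ²`). Then `Δu ≤ f` holds distributionally on all of `B`:
for every nonnegative test function `φ` one has `∫_B u·Δφ ≤ ∫_B f·φ`. -/
theorem subsolution_across_puncture (m : ℕ) (hm : 6 ≤ m)
    (u f : EuclideanSpace ℝ (Fin m) → ℝ)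
    (hu_nonneg : ∀ x ∈ Metric.ball (0 : EuclideanSpace ℝ (Fin m)) 1, 0 ≤ u x)
    (hu_smooth : ContDiffOn ℝ (⊤ : ℕ∞) u (Metric.ball (0 : EuclideanSpace ℝ (Fin m)) 1 \ {0}))
    (hu_L2 : IntegrableOn (fun x => u x ^ 2)
      (Metric.ball (0 : EuclideanSpace ℝ (Fin m)) 1) volume)
    (hgrad_L2 : IntegrableOn (fun x => ‖gradient u x‖ ^ 2)
      (Metric.ball (0 : EuclideanSpace ℝ (Fin m)) 1 \ {0}) volume)
    (hf : LocallyIntegrableOn f (Metric.ball (0 : EuclideanSpace ℝ (Fin m)) 1) volume)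
    (hsub : ∀ x ∈ Metric.ball (0 : EuclideanSpace ℝ (Fin m)) 1 \ {0},
      -(rawLaplacian m u x) ≤ f x) :
    ∀ φ : EuclideanSpace ℝ (Fin m) → ℝ, ContDiff ℝ (⊤ : ℕ∞) φ → HasCompactSupport φ →
      tsupport φ ⊆ Metric.ball (0 : EuclideanSpace ℝ (Fin m)) 1 → (∀ x, 0 ≤ φ x) →
      ∫ x in Metric.ball (0 : EuclideanSpace ℝ (Fin m)) 1, u x * (-(rawLaplacian m φ x)) ≤
        ∫ x in Metric.ball (0 : EuclideanSpace ℝ (Fin m)) 1, f x * φ x := by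
  intro φ hφ hφc hφB hφ0
  set B := ball (0 : EuclideanSpace ℝ (Fin m)) 1
  have : Nontrivial (EuclideanSpace ℝ (Fin m)) :=
    Module.nontrivial_of_finrank_pos (R := ℝ) (by simp; omega)
  obtain ⟨g, C, hg, hgc, hgsupp, hg0, hgle, hgC, hglim⟩ :=
    hφ.exists_seq_tsupport_subset_diff_zero hφc hφ0
  have hU : IsOpen (B \ {0}) := isOpen_ball.sdiff isClosed_singleton
  have hgU (n : ℕ) : tsupport (g n) ⊆ B \ {0} :=
    (hgsupp n).trans (Set.sdiff_subset_sdiff_left hφB)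
  have hgB (n : ℕ) {x} (hx : x ∉ B) : x ∉ tsupport (g n) := fun h => hx (hgU n h).1
  have hgreen (n : ℕ) := hu_smooth.integral_mul_rawLaplacian hU (hg n) (hgc n) (hgU n)
  have hne : ∀ᵐ x ∂volume.restrict B, x ≠ 0 := ae_restrict_of_ae (by simp [ae_iff])
  have hmem : ∀ᵐ x ∂volume.restrict B, x ∈ B := ae_restrict_mem measurableSet_ball
  have hfint {ψ : EuclideanSpace ℝ (Fin m) → ℝ} (hψ : Continuous ψ) (hψc : HasCompactSupport ψ)
      (hψB : tsupport ψ ⊆ B) : Integrable fun x => f x * ψ x := by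
    have h : IntegrableOn (fun x => f x * ψ x) (tsupport ψ) :=
      (hf.integrableOn_compact_subset hψB hψc.isCompact).mul_continuousOn hψ.continuousOn
        hψc.isCompact
    refine (integrableOn_iff_integrable_of_support_subset fun x hx => ?_).mp h
    by_contra hx'
    simp [image_eq_zero_of_notMem_tsupport hx'] at hx
  have hle (n : ℕ) : ∫ x in B, u x * (-(rawLaplacian m (g n) x)) ≤ ∫ x in B, f x * g n x := by
    obtain ⟨-, hLu, hparts⟩ := hgreen n
    rw [setIntegral_eq_integral_of_forall_compl_eq_zero fun x hx => by
        simp [rawLaplacian_eq_zero_of_notMem_tsupport (hgB n hx)],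
      setIntegral_eq_integral_of_forall_compl_eq_zero fun x hx => by
        simp [image_eq_zero_of_notMem_tsupport (hgB n hx)]]
    simp only [mul_neg, integral_neg, hparts]
    rw [← integral_neg]
    refine integral_mono hLu.neg (hfint (hg n).continuous (hgc n)
      ((hgU n).trans Set.sdiff_subset)) fun x => ?_
    by_cases hx : x ∈ tsupport (g n)
    · have := mul_le_mul_of_nonneg_right (hsub x (hgU n hx)) (hg0 n x)
      simpa using this
    · simp [image_eq_zero_of_notMem_tsupport hx]
  have hlim₁ : Tendsto (fun n => ∫ x in B, u x * (-(rawLaplacian m (g n) x))) atTop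
      (𝓝 (∫ x in B, u x * (-(rawLaplacian m φ x)))) := by
    refine tendsto_integral_of_dominated_convergence
      (fun x => |C| * (u x ^ 2 + (‖x‖ ^ 4)⁻¹)) (fun n => ?_) ?_ (fun n => ?_) ?_
    · simpa only [mul_neg] using! (hgreen n).1.neg.aestronglyMeasurable
    · exact (hu_L2.add (integrableOn_ball_inv_norm_pow (by omega) 1)).const_mul _
    · filter_upwards [hne, hmem] with x hx hxB
      have hx0 : 0 < ‖x‖ := norm_pos_iff.mpr hx
      have hb : |rawLaplacian m (g n) x| ≤ |C| * (‖x‖ ^ 2)⁻¹ := by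
        rw [← div_eq_mul_inv, le_div_iff₀ (by positivity), mul_comm]
        exact (hgC n x (mem_ball_zero_iff.mp hxB).le).trans (le_abs_self C)
      have h4 : (‖x‖ ^ 4)⁻¹ = ((‖x‖ ^ 2)⁻¹) ^ 2 := by rw [← inv_pow, ← inv_pow, ← pow_mul]
      have hu0 := hu_nonneg x hxB
      rw [norm_mul, norm_neg, Real.norm_of_nonneg hu0, Real.norm_eq_abs, h4]
      calc u x * |rawLaplacian m (g n) x| ≤ u x * (|C| * (‖x‖ ^ 2)⁻¹) := by gcongr
        _ = |C| * (u x * (‖x‖ ^ 2)⁻¹) := by ring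
        _ ≤ |C| * (u x ^ 2 + ((‖x‖ ^ 2)⁻¹) ^ 2) := by
          gcongr
          nlinarith [sq_nonneg (u x - (‖x‖ ^ 2)⁻¹), sq_nonneg (u x), sq_nonneg (‖x‖ ^ 2)⁻¹]
    · filter_upwards [hne] with x hx
      refine tendsto_const_nhds.congr' ?_
      filter_upwards [hglim x hx] with n hn
      rw [hn.rawLaplacian_eq]
  have hlim₂ : Tendsto (fun n => ∫ x in B, f x * g n x) atTop (𝓝 (∫ x in B, f x * φ x)) := by
    refine tendsto_integral_of_dominated_convergence (fun x => ‖f x * φ x‖) (fun n => ?_)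
      (hfint hφ.continuous hφc hφB).norm.integrableOn (fun n => ?_) ?_
    · exact (hfint (hg n).continuous (hgc n)
        ((hgU n).trans Set.sdiff_subset)).aestronglyMeasurable.restrict
    · refine ae_of_all _ fun x => ?_
      rw [norm_mul, norm_mul, Real.norm_of_nonneg (hg0 n x), Real.norm_of_nonneg (hφ0 x)]
      exact mul_le_mul_of_nonneg_left (hgle n x) (norm_nonneg _)
    · filter_upwards [hne] with x hx
      refine tendsto_const_nhds.congr' ?_
      filter_upwards [hglim x hx] with n hn
      rw [hn.self_of_nhds]
  exact le_of_tendsto_of_tendsto' hlim₁ hlim₂ hle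
end
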